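/- arXiv:2304.05955 — 5 statements merged into one kernel-verified Lean document; each statement's English description precedes it below -/
import Mathlib

section
/- Let ν, μ ∈ ℕ, h ∈ ℝ, A an ν×ν real matrix, B an ν×μ real matrix, and x, y_vec, y_int vectors in ℝ^ν and ℝ^μ respectively. Define the sequence ξ : ℕ → ℝ^ν by ξ(0) = (I + h•A)x + h•B y_vec and ξ(i+1) = (I + (h/2)•A)x + (h/2)•A (ξ(i)) + (h/2)•B (y_vec + y_int). Then for every r ≥ 1, ξ(r) = (I + h•C_r A) x + h•(C_r − (1/2)•C_{r−1}) B y_vec + (h/2)•C_{r−1} B y_int, where C_j := Σ_{i=0}^{j} ((h/2)•A)^i. -/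
open Matrix Finset

/-- The matrix geometric sum `C_j = ∑_{i=0}^{j} ((h/2) • A)^i`. -/
noncomputable def Cmat {n : Type*} [Fintype n] [DecidableEq n] {K : Type*} [Field K]
    (h : K) (A : Matrix n n K) (j : ℕ) : Matrix n n K :=
  ∑ i ∈ Finset.range (j + 1), ((h / 2) • A) ^ i

theorem Cmat_zero {n : Type*} [Fintype n] [DecidableEq n] {K : Type*} [Field K]
    (h : K) (A : Matrix n n K) : Cmat h A 0 = 1 := by
  simp [Cmat]

theorem Cmat_succ {n : Type*} [Fintype n] [DecidableEq n] {K : Type*} [Field K]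
    (h : K) (A : Matrix n n K) (j : ℕ) :
    Cmat h A (j + 1) = 1 + (h / 2) • (A * Cmat h A j) := by
  simp only [Cmat]
  rw [Finset.sum_range_succ', ← Matrix.smul_mul, Finset.mul_sum, pow_zero, add_comm]
  simp only [pow_succ']

/-- Closed form of the linearized Heun predictor–corrector iteration. -/
theorem heun_linearized_closed_form (ν μ : ℕ) (h : ℝ)
    (A : Matrix (Fin ν) (Fin ν) ℝ) (B : Matrix (Fin ν) (Fin μ) ℝ)
    (x : Fin ν → ℝ) (y_vec y_int : Fin μ → ℝ)
    (ξ : ℕ → Fin ν → ℝ)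
    (hξ0 : ξ 0 = (1 + h • A).mulVec x + (h • B).mulVec y_vec)
    (hξstep : ∀ i : ℕ,
      ξ (i + 1) = (1 + (h / 2) • A).mulVec x + ((h / 2) • A).mulVec (ξ i)
        + ((h / 2) • B).mulVec (y_vec + y_int)) :
    ∀ r : ℕ, 1 ≤ r →
      ξ r = (1 + h • (Cmat h A r * A)).mulVec x
        + (h • ((Cmat h A r - (1 / 2 : ℝ) • Cmat h A (r - 1)) * B)).mulVec y_vec
        + ((h / 2) • (Cmat h A (r - 1) * B)).mulVec y_int := by
  intro r hr
  induction r, hr using Nat.le_induction with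
  | base =>
    rw [hξstep 0, hξ0, Nat.sub_self, Cmat_succ h A 0, Cmat_zero]
    simp only [add_mul, smul_mul_assoc, mul_one, one_mul, add_mulVec, sub_mulVec,
      smul_mulVec, mulVec_add, mulVec_smul, ← mulVec_mulVec, one_mulVec]
    module
  | succ r hr ih =>
    obtain ⟨k, rfl⟩ := Nat.exists_eq_add_of_le' hr
    rw [hξstep, ih, Nat.add_sub_cancel, Nat.add_sub_cancel, Cmat_succ h A (k + 1), Cmat_succ h A k]
    simp only [add_mul, smul_mul_assoc, mul_add, mul_one, one_mul, add_mulVec, sub_mulVec,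
      smul_mulVec, mulVec_add, mulVec_sub, mulVec_smul, ← mulVec_mulVec, one_mulVec]
    module
end

section
/- Let ν, μ ∈ ℕ with matrices f_x : ℝ^{ν×ν}, f_y : ℝ^{ν×μ}, g_x : ℝ^{μ×ν}, and g_y : ℝ^{μ×μ} invertible. Set A_s := f_x − f_y g_y⁻¹ g_x, h ∈ ℝ, r ≥ 1, C_j := Σ_{i=0}^{j} ((h/2)•f_x)^i, and M := (h/2)•C_{r−1} f_y g_y⁻¹ g_x. If x_n, x_{n+1} ∈ ℝ^ν and y_n, y_{n+1} ∈ ℝ^μ satisfy g_x x_n + g_y y_n = 0, g_x x_{n+1} + g_y y_{n+1} = 0, and x_{n+1} = (I + h•C_r f_x) x_n + (h•C_r − (h/2)•C_{r−1}) f_y y_n + (h/2)•C_{r−1} f_y y_{n+1}, then (I + M) x_{n+1} = (I + h•C_r A_s + M) x_n. -/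
open Matrix Finset

/-- Solving the linear algebraic constraint `B x + G y = 0` for `y` when `G` is invertible. -/
theorem eq_neg_inv_mul_mulVec_of_mulVec_add_mulVec_eq_zero {m n K : Type*} [Fintype m]
    [DecidableEq m] [Fintype n] [Field K] {B : Matrix m n K} {G : Matrix m m K}
    (hG : IsUnit G.det) {x : n → K} {y : m → K} (hxy : B.mulVec x + G.mulVec y = 0) :
    y = -(G⁻¹ * B).mulVec x := by
  have hy := congrArg G⁻¹.mulVec hxy
  rw [Matrix.mulVec_add, Matrix.mulVec_mulVec, Matrix.mulVec_mulVec,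
    Matrix.nonsing_inv_mul G hG, Matrix.one_mulVec, Matrix.mulVec_zero] at hy
  exact eq_neg_of_add_eq_zero_right hy

/-- Dense-matrix form of the linearized Heun step with perfect interfacing
(`y_int = y_{n+1}`): on the algebraic constraint manifold, the step reduces to
`(I + M) x_{n+1} = (I + h C_r A_s + M) x_n` with `A_s = f_x − f_y g_y⁻¹ g_x` and
`M = (h/2) C_{r−1} f_y g_y⁻¹ g_x`. -/
theorem heun_perfect_interfacing_dense_form (ν μ : ℕ) (h : ℝ) (r : ℕ) (hr : 1 ≤ r)
    (f_x : Matrix (Fin ν) (Fin ν) ℝ) (f_y : Matrix (Fin ν) (Fin μ) ℝ)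
    (g_x : Matrix (Fin μ) (Fin ν) ℝ) (g_y : Matrix (Fin μ) (Fin μ) ℝ)
    (hgy : IsUnit g_y.det)
    (x_n x_np1 : Fin ν → ℝ) (y_n y_np1 : Fin μ → ℝ)
    (halgn : g_x.mulVec x_n + g_y.mulVec y_n = 0)
    (halgnp1 : g_x.mulVec x_np1 + g_y.mulVec y_np1 = 0)
    (hstep : x_np1 = (1 + h • (Cmat h f_x r * f_x)).mulVec x_n
        + ((h • Cmat h f_x r - (h / 2) • Cmat h f_x (r - 1)) * f_y).mulVec y_n
        + (((h / 2) • Cmat h f_x (r - 1)) * f_y).mulVec y_np1) :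
    (1 + (h / 2) • (Cmat h f_x (r - 1) * (f_y * g_y⁻¹ * g_x))).mulVec x_np1
      = (1 + h • (Cmat h f_x r * (f_x - f_y * g_y⁻¹ * g_x))
          + (h / 2) • (Cmat h f_x (r - 1) * (f_y * g_y⁻¹ * g_x))).mulVec x_n := by
  rw [eq_neg_inv_mul_mulVec_of_mulVec_add_mulVec_eq_zero hgy halgn,
    eq_neg_inv_mul_mulVec_of_mulVec_add_mulVec_eq_zero hgy halgnp1] at hstep
  rw [Matrix.add_mulVec, Matrix.one_mulVec]
  nth_rewrite 1 [hstep]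
  simp only [Matrix.mulVec_neg, Matrix.mulVec_mulVec, Matrix.add_mulVec, Matrix.sub_mulVec,
    Matrix.smul_mulVec, Matrix.mul_sub, Matrix.sub_mul, Matrix.smul_mul, Matrix.mul_assoc,
    smul_sub]
  abel
end

section
/- Let ν, μ ∈ ℕ with μ ≥ 1 and complex matrices f_x : ℂ^{ν×ν}, f_y : ℂ^{ν×μ}, g_x : ℂ^{μ×ν}, and g_y : ℂ^{μ×μ} invertible. Set A_s := f_x − f_y g_y⁻¹ g_x, E := [[I, 0],[0, 0]], and A := [[f_x, f_y],[g_x, g_y]]. Then for every w ∈ ℂ, det(E − w•A) = (−w)^μ · det(g_y) · det(I − w•A_s); consequently, the polynomial w ↦ det(E − w•A) vanishes at w = 0 to order exactly μ, i.e., the reciprocal pencil E − w•A has the eigenvalue 0 (equivalently, the pencil s•E − A has the infinite eigenvalue) with algebraic multiplicity μ. -/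
open Matrix Polynomial

/-- Schur-complement factorization of the determinant of the reciprocal pencil, over any
commutative ring. -/
theorem det_reciprocal_pencil {R m n : Type*} [CommRing R] [Fintype m] [DecidableEq m]
    [Fintype n] [DecidableEq n] (a : Matrix m m R) (b : Matrix m n R) (c : Matrix n m R)
    (d : Matrix n n R) (hd : IsUnit d.det) (w : R) :
    (Matrix.fromBlocks (1 : Matrix m m R) 0 0 0 - w • Matrix.fromBlocks a b c d).det
      = (-w) ^ Fintype.card n * d.det * (1 - w • (a - b * d⁻¹ * c)).det := by
  have hfac : Matrix.fromBlocks (1 : Matrix m m R) 0 0 0 - w • Matrix.fromBlocks a b c d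
      = Matrix.fromBlocks 1 0 0 ((-w) • (1 : Matrix n n R))
        * Matrix.fromBlocks (1 - w • a) (-(w • b)) c d := by
    simp [Matrix.fromBlocks_multiply, Matrix.fromBlocks_smul, sub_eq_add_neg,
      Matrix.fromBlocks_neg, Matrix.fromBlocks_add]
  let := Matrix.invertibleOfIsUnitDet d hd
  rw [hfac, Matrix.det_mul, Matrix.det_fromBlocks_zero₂₁, Matrix.det_fromBlocks₂₂,
    Matrix.invOf_eq_nonsing_inv, Matrix.det_smul, Matrix.det_one, Matrix.det_one, one_mul,
    mul_one, mul_assoc]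
  congr 3
  simp only [Matrix.neg_mul, Matrix.smul_mul, smul_sub]
  abel

/-- A polynomial `(-X) ^ k * q` with `q(0) ≠ 0` vanishes at `0` to order exactly `k`. -/
theorem rootMultiplicity_zero_neg_X_pow_mul {R : Type*} [CommRing R] [IsDomain R] (k : ℕ)
    {q : R[X]} (hq : q.eval 0 ≠ 0) :
    Polynomial.rootMultiplicity 0 ((-X) ^ k * q) = k := by
  have hr : ((-1 : R[X]) ^ k * q).eval 0 ≠ 0 := by simpa using hq
  have hr0 : (-1 : R[X]) ^ k * q ≠ 0 := fun h => hr (by rw [h, eval_zero])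
  have h : (-X) ^ k * q = ((-1 : R[X]) ^ k * q) * (X - C 0) ^ k := by
    rw [neg_pow, C_0, sub_zero]
    ring
  rw [h, rootMultiplicity_mul_X_sub_C_pow hr0, rootMultiplicity_eq_zero hr, zero_add]

/-- The reciprocal pencil `E − w•A` of the DAE pencil `s•E − A`, with `E = [[I,0],[0,0]]`
and `A = [[f_x, f_y],[g_x, g_y]]`, satisfies
`det(E − w•A) = (−w)^μ · det(g_y) · det(I − w•A_s)`; consequently its determinant,
as a polynomial in `w`, vanishes at `w = 0` to order exactly `μ`, i.e., the pencil
`s•E − A` has the infinite eigenvalue with algebraic multiplicity `μ`. -/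
theorem reciprocal_pencil_infinite_eigenvalue (ν μ : ℕ) (hμ : 1 ≤ μ)
    (f_x : Matrix (Fin ν) (Fin ν) ℂ) (f_y : Matrix (Fin ν) (Fin μ) ℂ)
    (g_x : Matrix (Fin μ) (Fin ν) ℂ) (g_y : Matrix (Fin μ) (Fin μ) ℂ)
    (hgy : IsUnit g_y.det) :
    (∀ w : ℂ,
      ((Matrix.fromBlocks (1 : Matrix (Fin ν) (Fin ν) ℂ) 0 0 0)
        - w • Matrix.fromBlocks f_x f_y g_x g_y).det
        = (-w) ^ μ * g_y.det
          * ((1 : Matrix (Fin ν) (Fin ν) ℂ)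
              - w • (f_x - f_y * g_y⁻¹ * g_x)).det)
    ∧ Polynomial.rootMultiplicity 0
        (((Matrix.fromBlocks (1 : Matrix (Fin ν) (Fin ν) ℂ) 0 0 0).map Polynomial.C
          - (Polynomial.X : Polynomial ℂ)
              • ((Matrix.fromBlocks f_x f_y g_x g_y).map Polynomial.C)).det)
      = μ := by
  refine ⟨fun w => by simpa using det_reciprocal_pencil f_x f_y g_x g_y hgy w, ?_⟩
  have hdet : (g_y.map C).det = C g_y.det := (RingHom.map_det C g_y).symm
  have hunit : IsUnit (g_y.map C).det := hdet ▸ hgy.map C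
  have hE : (Matrix.fromBlocks (1 : Matrix (Fin ν) (Fin ν) ℂ) 0 0
      (0 : Matrix (Fin μ) (Fin μ) ℂ)).map C = Matrix.fromBlocks 1 0 0 0 := by
    simp [Matrix.fromBlocks_map]
  rw [hE, Matrix.fromBlocks_map, det_reciprocal_pencil _ _ _ _ hunit, Fintype.card_fin,
    mul_assoc]
  apply rootMultiplicity_zero_neg_X_pow_mul
  rw [eval_mul, hdet, eval_C, ← coe_evalRingHom, RingHom.map_det, map_sub, map_one]
  have hzero (M : Matrix (Fin ν) (Fin ν) ℂ[X]) :
      (evalRingHom (0 : ℂ)).mapMatrix ((X : ℂ[X]) • M) = 0 := by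
    ext i j
    simp
  rw [hzero, sub_zero, Matrix.det_one, mul_one]
  exact hgy.ne_zero
end

section
/- Let ν, μ ∈ ℕ with μ ≥ 1 and complex matrices f_x : ℂ^{ν×ν}, f_y : ℂ^{ν×μ}, g_x : ℂ^{μ×ν}, and g_y : ℂ^{μ×μ} invertible. Set A_s := f_x − f_y g_y⁻¹ g_x, h ∈ ℂ, r ∈ ℕ, and C_r := Σ_{j=0}^{r} ((h/2)•f_x)^j. Then for every z ∈ ℂ, det( z•[[I, 0],[g_x, g_y]] − [[I + h•C_r f_x, h•C_r f_y],[0, 0]] ) = z^μ · det(g_y) · det( z•I − (I + h•C_r A_s) ). In particular, a nonzero z ∈ ℂ is an eigenvalue of the sparse pencil P_PC(z) if and only if it is an eigenvalue of the matrix I + h•C_r A_s. -/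
open Matrix Finset

/-- Schur complement formula for a block matrix whose lower blocks carry a common scalar factor,
which is allowed to vanish. -/
theorem det_fromBlocks_smul_lower {m n R : Type*} [Fintype m] [DecidableEq m] [Fintype n]
    [DecidableEq n] [CommRing R] (z : R) (A : Matrix m m R) (B : Matrix m n R)
    (C : Matrix n m R) (D : Matrix n n R) (hD : IsUnit D.det) :
    (Matrix.fromBlocks A B (z • C) (z • D)).det
      = z ^ Fintype.card n * D.det * (A - B * D⁻¹ * C).det := by
  have hmul : Matrix.fromBlocks A B (z • C) (z • D) * Matrix.fromBlocks 1 0 (-(D⁻¹ * C)) 1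
      = Matrix.fromBlocks (A - B * D⁻¹ * C) B 0 (z • D) := by
    simp [Matrix.fromBlocks_multiply, Matrix.mul_assoc, Matrix.mul_nonsing_inv_cancel_left _ _ hD,
      sub_eq_add_neg]
  have hdet := congrArg Matrix.det hmul
  rw [Matrix.det_mul, Matrix.det_fromBlocks_zero₁₂, Matrix.det_fromBlocks_zero₂₁, Matrix.det_one,
    Matrix.det_one, mul_one, mul_one, Matrix.det_smul] at hdet
  rw [hdet, mul_comm]

/-- The eigenvalues of a matrix over a field are the zeros of its characteristic determinant. -/
theorem hasEigenvalue_toLin'_iff_det_eq_zero {n K : Type*} [Fintype n] [DecidableEq n] [Field K]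
    (M : Matrix n n K) (z : K) :
    Module.End.HasEigenvalue (Matrix.toLin' M) z ↔ (z • (1 : Matrix n n K) - M).det = 0 := by
  rw [Module.End.hasEigenvalue_iff_isRoot_charpoly, Matrix.charpoly_toLin', Polynomial.IsRoot,
    Matrix.eval_charpoly, Matrix.scalar_apply, Matrix.smul_one_eq_diagonal]

/-- The determinant of the sparse pencil `P_PC(z)` of the linearized Heun scheme with
interfacing by extrapolation factors as
`det P_PC(z) = z^μ · det(g_y) · det(z•I − (I + h C_r A_s))`; in particular, a nonzero `z`
is an eigenvalue of `P_PC(z)` iff it is an eigenvalue of `I + h C_r A_s`. -/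
theorem heun_extrapolation_pencil_det (ν μ : ℕ) (hμ : 1 ≤ μ) (h : ℂ) (r : ℕ)
    (f_x : Matrix (Fin ν) (Fin ν) ℂ) (f_y : Matrix (Fin ν) (Fin μ) ℂ)
    (g_x : Matrix (Fin μ) (Fin ν) ℂ) (g_y : Matrix (Fin μ) (Fin μ) ℂ)
    (hgy : IsUnit g_y.det) :
    (∀ z : ℂ,
      (z • (Matrix.fromBlocks (1 : Matrix (Fin ν) (Fin ν) ℂ) 0 g_x g_y)
        - Matrix.fromBlocks (1 + h • (Cmat h f_x r * f_x)) (h • (Cmat h f_x r * f_y))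
            0 0).det
        = z ^ μ * g_y.det
          * (z • (1 : Matrix (Fin ν) (Fin ν) ℂ)
              - (1 + h • (Cmat h f_x r * (f_x - f_y * g_y⁻¹ * g_x)))).det)
    ∧ ∀ z : ℂ, z ≠ 0 →
      ((z • (Matrix.fromBlocks (1 : Matrix (Fin ν) (Fin ν) ℂ) 0 g_x g_y)
        - Matrix.fromBlocks (1 + h • (Cmat h f_x r * f_x)) (h • (Cmat h f_x r * f_y))
            0 0).det = 0
        ↔ Module.End.HasEigenvalue
            (Matrix.toLin' (1 + h • (Cmat h f_x r * (f_x - f_y * g_y⁻¹ * g_x)))) z) := by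
  have hdet : ∀ z : ℂ,
      (z • (Matrix.fromBlocks (1 : Matrix (Fin ν) (Fin ν) ℂ) 0 g_x g_y)
        - Matrix.fromBlocks (1 + h • (Cmat h f_x r * f_x)) (h • (Cmat h f_x r * f_y))
            0 0).det
        = z ^ μ * g_y.det
          * (z • (1 : Matrix (Fin ν) (Fin ν) ℂ)
              - (1 + h • (Cmat h f_x r * (f_x - f_y * g_y⁻¹ * g_x)))).det := by
    intro z
    rw [Matrix.fromBlocks_smul, sub_eq_add_neg, Matrix.fromBlocks_neg, Matrix.fromBlocks_add,
      neg_zero, neg_zero, add_zero, add_zero, det_fromBlocks_smul_lower _ _ _ _ _ hgy,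
      Fintype.card_fin]
    congr 2
    simp only [smul_zero, zero_add, Matrix.neg_mul, Matrix.smul_mul, Matrix.mul_sub, smul_sub,
      Matrix.mul_assoc]
    abel
  refine ⟨hdet, fun z hz => ?_⟩
  rw [hdet, hasEigenvalue_toLin'_iff_det_eq_zero, mul_eq_zero,
    or_iff_right (mul_ne_zero (pow_ne_zero μ hz) hgy.ne_zero)]
end

section
/- Let ν, μ ∈ ℕ with complex matrices f_x : ℂ^{ν×ν}, f_y : ℂ^{ν×μ}, g_x : ℂ^{μ×ν}, and g_y : ℂ^{μ×μ} invertible. Set E := [[I, 0],[0, 0]]. Then for every s ∈ ℂ and every h ∈ ℝ, det( s•E − [[f_x, 0],[g_x, g_y]] − exp(−s·h)•[[0, f_y],[0, 0]] ) = det(−g_y) · det( s•I − f_x + exp(−s·h)• f_y g_y⁻¹ g_x ). Hence s ∈ ℂ is a root of the determinant of the sparse delay pencil P_d(s) if and only if it is a root of the determinant of the dense delay pencil s•I − f_x + e^{−sh} f_y g_y⁻¹ g_x. -/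
open Matrix

/-- The determinant of the sparse delay pencil
`P_d(s) = s•E − [[f_x, 0],[g_x, g_y]] − e^{−sh}•[[0, f_y],[0, 0]]` factors as
`det P_d(s) = det(−g_y) · det(s•I − f_x + e^{−sh} f_y g_y⁻¹ g_x)`; hence `s` is a root of
the sparse delay pencil's determinant iff it is a root of the dense one's. -/
theorem delay_pencil_det_eq_dense (ν μ : ℕ)
    (f_x : Matrix (Fin ν) (Fin ν) ℂ) (f_y : Matrix (Fin ν) (Fin μ) ℂ)
    (g_x : Matrix (Fin μ) (Fin ν) ℂ) (g_y : Matrix (Fin μ) (Fin μ) ℂ)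
    (hgy : IsUnit g_y.det) :
    ∀ (s : ℂ) (h : ℝ),
      (s • (Matrix.fromBlocks (1 : Matrix (Fin ν) (Fin ν) ℂ) 0 0 0)
        - Matrix.fromBlocks f_x 0 g_x g_y
        - Complex.exp (-(s * (h : ℂ))) • Matrix.fromBlocks 0 f_y 0 0).det
      = (-g_y).det
        * (s • (1 : Matrix (Fin ν) (Fin ν) ℂ) - f_x
            + Complex.exp (-(s * (h : ℂ))) • (f_y * g_y⁻¹ * g_x)).det
      ∧ ((s • (Matrix.fromBlocks (1 : Matrix (Fin ν) (Fin ν) ℂ) 0 0 0)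
          - Matrix.fromBlocks f_x 0 g_x g_y
          - Complex.exp (-(s * (h : ℂ))) • Matrix.fromBlocks 0 f_y 0 0).det = 0
        ↔ (s • (1 : Matrix (Fin ν) (Fin ν) ℂ) - f_x
            + Complex.exp (-(s * (h : ℂ))) • (f_y * g_y⁻¹ * g_x)).det = 0) := by
  intro s h
  have hneg : IsUnit (-g_y).det :=
    (isUnit_iff_isUnit_det (-g_y)).mp ((isUnit_iff_isUnit_det g_y).mpr hgy).neg
  have hinv : (-g_y)⁻¹ = -g_y⁻¹ :=
    inv_eq_right_inv (by rw [neg_mul_neg, mul_nonsing_inv g_y hgy])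
  have hdet : (s • (Matrix.fromBlocks (1 : Matrix (Fin ν) (Fin ν) ℂ) 0 0 0)
        - Matrix.fromBlocks f_x 0 g_x g_y
        - Complex.exp (-(s * (h : ℂ))) • Matrix.fromBlocks 0 f_y 0 0).det
      = (-g_y).det
        * (s • (1 : Matrix (Fin ν) (Fin ν) ℂ) - f_x
            + Complex.exp (-(s * (h : ℂ))) • (f_y * g_y⁻¹ * g_x)).det := by
    let := invertibleOfIsUnitDet (-g_y) hneg
    have hblocks : s • (Matrix.fromBlocks (1 : Matrix (Fin ν) (Fin ν) ℂ) 0 0 0)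
          - Matrix.fromBlocks f_x 0 g_x g_y
          - Complex.exp (-(s * (h : ℂ))) • Matrix.fromBlocks 0 f_y 0 0
        = Matrix.fromBlocks (s • 1 - f_x) (-(Complex.exp (-(s * (h : ℂ))) • f_y))
            (-g_x) (-g_y) := by
      simp [fromBlocks_smul, sub_eq_add_neg, fromBlocks_neg, fromBlocks_add]
    rw [hblocks, det_fromBlocks₂₂, invOf_eq_nonsing_inv, hinv]
    simp
  exact ⟨hdet, by rw [hdet, mul_eq_zero, or_iff_right hneg.ne_zero]⟩
end
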